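/- arXiv:1412.2637 — 3 statements merged into one kernel-verified Lean document; each statement's English description precedes it below -/
import Mathlib

section
/- Let ε, μ > 0 be real constants and t₀ ∈ ℝ. Let E, H ∈ (MvPolynomial (Fin 4) ℝ)³ be triples of real polynomials in the variables (x₁, x₂, x₃, t) satisfying the polynomial Maxwell equations ε·∂ₜE = curl H and μ·∂ₜH = −curl E. If substituting t := t₀ into div E yields the zero polynomial and substituting t := t₀ into div H yields the zero polynomial, then div E = 0 and div H = 0 identically as polynomials in (x₁, x₂, x₃, t). -/
open MvPolynomial

noncomputable section

/-- The spatial curl of a triple of polynomials in the variables `(x₁, x₂, x₃, t)`. -/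
def curl4 (F : Fin 3 → MvPolynomial (Fin 4) ℝ) : Fin 3 → MvPolynomial (Fin 4) ℝ :=
  ![pderiv 1 (F 2) - pderiv 2 (F 1),
    pderiv 2 (F 0) - pderiv 0 (F 2),
    pderiv 0 (F 1) - pderiv 1 (F 0)]

lemma curl4_add (F G : Fin 3 → MvPolynomial (Fin 4) ℝ) :
    curl4 (F + G) = curl4 F + curl4 G := by
  funext i
  fin_cases i <;> simp [curl4, map_add] <;> ring

lemma curl4_smul (c : ℝ) (F : Fin 3 → MvPolynomial (Fin 4) ℝ) :
    curl4 (c • F) = c • curl4 F := by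
  funext i
  fin_cases i <;> simp [curl4, map_smul, smul_sub]

lemma curl4_zero : curl4 0 = 0 := by
  funext i
  fin_cases i <;> simp [curl4]

/-- The Trefftz space `𝕋_p`: pairs `(E, H)` of polynomial vector fields in the
variables `(x₁, x₂, x₃, t)` of total degree at most `p` satisfying the polynomial
Maxwell equations `ε ∂ₜ E = curl H` and `μ ∂ₜ H = - curl E`. -/
def TrefftzSpace (p : ℕ) (ε μ : ℝ) :
    Submodule ℝ ((Fin 3 → MvPolynomial (Fin 4) ℝ) × (Fin 3 → MvPolynomial (Fin 4) ℝ)) where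
  carrier := { EH |
    (∀ i, (EH.1 i).totalDegree ≤ p) ∧ (∀ i, (EH.2 i).totalDegree ≤ p) ∧
    (∀ i, ε • pderiv 3 (EH.1 i) = curl4 EH.2 i) ∧
    (∀ i, μ • pderiv 3 (EH.2 i) = - curl4 EH.1 i) }
  add_mem' := by
    rintro a b ⟨ha1, ha2, ha3, ha4⟩ ⟨hb1, hb2, hb3, hb4⟩
    refine ⟨fun i => ?_, fun i => ?_, fun i => ?_, fun i => ?_⟩
    · exact (totalDegree_add _ _).trans (max_le (ha1 i) (hb1 i))
    · exact (totalDegree_add _ _).trans (max_le (ha2 i) (hb2 i))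
    · show ε • pderiv 3 (a.1 i + b.1 i) = curl4 (a.2 + b.2) i
      rw [curl4_add, map_add, smul_add, ha3 i, hb3 i, Pi.add_apply]
    · show μ • pderiv 3 (a.2 i + b.2 i) = - curl4 (a.1 + b.1) i
      rw [curl4_add, map_add, smul_add, ha4 i, hb4 i, Pi.add_apply, neg_add]
  zero_mem' := by
    refine ⟨fun i => ?_, fun i => ?_, fun i => ?_, fun i => ?_⟩ <;>
      simp [curl4_zero]
  smul_mem' := by
    rintro c a ⟨ha1, ha2, ha3, ha4⟩
    refine ⟨fun i => ?_, fun i => ?_, fun i => ?_, fun i => ?_⟩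
    · exact (totalDegree_smul_le c (a.1 i)).trans (ha1 i)
    · exact (totalDegree_smul_le c (a.2 i)).trans (ha2 i)
    · show ε • pderiv 3 (c • a.1 i) = curl4 (c • a.2) i
      rw [curl4_smul, Derivation.map_smul, smul_comm, ha3 i, Pi.smul_apply]
    · show μ • pderiv 3 (c • a.2 i) = - curl4 (c • a.1) i
      rw [curl4_smul, Derivation.map_smul, smul_comm, ha4 i, Pi.smul_apply, smul_neg]


/-- The spatial divergence of a triple of polynomials in the variables `(x₁, x₂, x₃, t)`. -/
def div4 (F : Fin 3 → MvPolynomial (Fin 4) ℝ) : MvPolynomial (Fin 4) ℝ :=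
  pderiv 0 (F 0) + pderiv 1 (F 1) + pderiv 2 (F 2)

/-- Substitution `t := t₀`: the ℝ-algebra homomorphism sending `x₁, x₂, x₃` to
themselves and the fourth variable `t` to the constant `t₀`. -/
def substT (t₀ : ℝ) : MvPolynomial (Fin 4) ℝ →ₐ[ℝ] MvPolynomial (Fin 3) ℝ :=
  aeval ![X 0, X 1, X 2, C t₀]

lemma pderiv_swap4 (i j : Fin 4) (p : MvPolynomial (Fin 4) ℝ) :
    pderiv i (pderiv j p) = pderiv j (pderiv i p) := by
  have h : ⁅(pderiv i : Derivation ℝ (MvPolynomial (Fin 4) ℝ) (MvPolynomial (Fin 4) ℝ)),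
      (pderiv j : Derivation ℝ (MvPolynomial (Fin 4) ℝ) (MvPolynomial (Fin 4) ℝ))⁆ = 0 := by
    apply MvPolynomial.derivation_ext
    intro k
    rw [Derivation.commutator_apply]
    simp only [pderiv_X, Pi.single_apply]
    split_ifs <;> simp
  have h2 := congrArg (fun D => D p) h
  simp only [Derivation.commutator_apply, Derivation.coe_zero, Pi.zero_apply] at h2
  exact sub_eq_zero.mp h2

lemma eq_zero_of_pderiv_substT (t₀ : ℝ) (p : MvPolynomial (Fin 4) ℝ)
    (hd : pderiv 3 p = 0) (hs : substT t₀ p = 0) : p = 0 := by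
  have hv : (3 : Fin 4) ∉ p.vars := by
    intro hmem
    obtain ⟨m, hm, h3⟩ := (mem_vars _).mp hmem
    have h3' : m 3 ≠ 0 := Finsupp.mem_support_iff.mp h3
    have hle : Finsupp.single (3 : Fin 4) 1 ≤ m := by
      rw [Finsupp.single_le_iff]; omega
    have hc := coeff_pderiv (i := 3) p (m - Finsupp.single 3 1)
    rw [hd, tsub_add_cancel_of_le hle, coeff_zero] at hc
    have hm' := mem_support_iff.mp hm
    rcases mul_eq_zero.mp hc.symm with h | h
    · exact hm' h
    · exact (Nat.cast_add_one_ne_zero _) h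
  obtain ⟨q, rfl⟩ := exists_rename_eq_of_vars_subset_range p
    (Fin.castSucc : Fin 3 → Fin 4) (Fin.castSucc_injective 3) (by
      intro k hk
      have : k ≠ 3 := by rintro rfl; exact hv hk
      exact ⟨k.castPred this, Fin.castSucc_castPred k this⟩)
  have hq : substT t₀ (rename Fin.castSucc q) = q := by
    rw [substT, aeval_rename]
    have : (![X 0, X 1, X 2, C t₀] : Fin 4 → MvPolynomial (Fin 3) ℝ) ∘ Fin.castSucc = X := by
      funext k
      fin_cases k <;> rfl
    rw [this, aeval_X_left_apply]
  rw [hq] at hs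
  rw [hs, map_zero]

lemma div4_curl4 (F : Fin 3 → MvPolynomial (Fin 4) ℝ) : div4 (curl4 F) = 0 := by
  simp only [div4, curl4, Matrix.cons_val, map_sub]
  rw [pderiv_swap4 1 0, pderiv_swap4 2 0, pderiv_swap4 2 1]
  ring

lemma div4_dt (c : ℝ) (hc : c ≠ 0) (F G : Fin 3 → MvPolynomial (Fin 4) ℝ)
    (h : ∀ i, c • pderiv 3 (F i) = G i) (hG : div4 G = 0) : pderiv 3 (div4 F) = 0 := by
  have : c • pderiv 3 (div4 F) = 0 := by
    rw [← hG]
    simp only [div4, ← h, map_add, Derivation.map_smul, smul_add]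
    rw [pderiv_swap4 3 0, pderiv_swap4 3 1, pderiv_swap4 3 2]
  exact (smul_eq_zero.mp this).resolve_left hc

/-- If `(E, H)` satisfies the polynomial Maxwell equations and the divergences of `E`
and `H` vanish at time `t = t₀`, then they vanish identically. -/
theorem trefftz_divergence_propagation (ε μ : ℝ) (hε : 0 < ε) (hμ : 0 < μ) (t₀ : ℝ)
    (E H : Fin 3 → MvPolynomial (Fin 4) ℝ)
    (hmaxwell1 : ∀ i, ε • pderiv 3 (E i) = curl4 H i)
    (hmaxwell2 : ∀ i, μ • pderiv 3 (H i) = - curl4 E i)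
    (hdivE : substT t₀ (div4 E) = 0) (hdivH : substT t₀ (div4 H) = 0) :
    div4 E = 0 ∧ div4 H = 0 := by
  refine ⟨eq_zero_of_pderiv_substT t₀ _ ?_ hdivE, eq_zero_of_pderiv_substT t₀ _ ?_ hdivH⟩
  · exact div4_dt ε hε.ne' E _ hmaxwell1 (div4_curl4 H)
  · refine div4_dt μ hμ.ne' H (fun i => - curl4 E i) hmaxwell2 ?_
    have := div4_curl4 E
    simp only [div4, map_neg] at this ⊢
    linear_combination -this

end
end

section
/- Let p ∈ ℕ, let ε, μ > 0 be real constants, let K = [a₁,b₁] × [a₂,b₂] × [a₃,b₃] ⊂ ℝ³ be a closed box with aᵢ < bᵢ for all i, and let t₀ < t₁ be reals. Then there exists a constant C > 0 such that for every pair (E, H) in the Trefftz space 𝕋_p, one has ∫_{K × [t₀,t₁]} (ε·|E(x,t)|² + μ·|H(x,t)|²) d(x,t) ≤ C · ∫_K (ε·|E(x,t₀)|² + μ·|H(x,t₀)|²) dx, where E(x,t) ∈ ℝ³ and H(x,t) ∈ ℝ³ denote the componentwise evaluations of the polynomial triples at the point (x,t), |·| is the Euclidean norm on ℝ³, and the integrals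 are taken with respect to Lebesgue measure on ℝ⁴ and ℝ³ respectively. -/
open MvPolynomial

noncomputable section

open MeasureTheory

/-- The electromagnetic energy density `ε|E(x,t)|² + μ|H(x,t)|²` obtained by evaluating
the polynomial fields at the point `(x, t) ∈ ℝ³ × ℝ`. -/
def energyDensity (ε μ : ℝ) (E H : Fin 3 → MvPolynomial (Fin 4) ℝ)
    (x : Fin 3 → ℝ) (t : ℝ) : ℝ :=
  ε * ∑ i, (eval (Fin.snoc x t) (E i)) ^ 2 + μ * ∑ i, (eval (Fin.snoc x t) (H i)) ^ 2

/-- Restriction of a polynomial to the line through `z` in direction `i`. -/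
def lineRestr (z : Fin 4 → ℝ) (i : Fin 4) : MvPolynomial (Fin 4) ℝ →ₐ[ℝ] Polynomial ℝ :=
  aeval (Function.update (fun j => Polynomial.C (z j)) i Polynomial.X)

lemma eval_lineRestr (z : Fin 4 → ℝ) (i : Fin 4) (s : ℝ) (f : MvPolynomial (Fin 4) ℝ) :
    (lineRestr z i f).eval s = eval (Function.update z i s) f := by
  have : (Polynomial.evalRingHom s).comp (lineRestr z i).toRingHom
      = eval (Function.update z i s) := by
    apply MvPolynomial.ringHom_ext
    · intro r
      simp [lineRestr]
    · intro j
      by_cases h : j = i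
      · subst h; simp [lineRestr]
      · simp [lineRestr, h]
  exact DFunLike.congr_fun this f

lemma derivative_lineRestr (z : Fin 4 → ℝ) (i : Fin 4) (f : MvPolynomial (Fin 4) ℝ) :
    Polynomial.derivative (lineRestr z i f) = lineRestr z i (pderiv i f) := by
  induction f using MvPolynomial.induction_on with
  | C r => simp [lineRestr]
  | add f g hf hg => simp [hf, hg]
  | mul_X f j hf =>
    simp only [map_mul, Derivation.leibniz, Polynomial.derivative_mul, hf, smul_eq_mul, map_add]
    by_cases h : j = i
    · subst h
      simp [lineRestr]; ring
    · have h' : pderiv i (X j : MvPolynomial (Fin 4) ℝ) = 0 := pderiv_X_of_ne h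
      simp [lineRestr, h, h', mul_comm]

/-- Vanishing on the hyperplane `t = t₀`. -/
def VanAt (t₀ : ℝ) (f : MvPolynomial (Fin 4) ℝ) : Prop :=
  ∀ z : Fin 4 → ℝ, z 3 = t₀ → eval z f = 0

lemma VanAt.pderiv {t₀ : ℝ} {f : MvPolynomial (Fin 4) ℝ} (hf : VanAt t₀ f) {i : Fin 4}
    (hi : i ≠ 3) : VanAt t₀ (pderiv i f) := by
  intro z hz
  have h0 : lineRestr z i f = 0 := by
    apply Polynomial.funext
    intro s
    rw [eval_lineRestr, hf _ (by rw [Function.update_of_ne hi.symm]; exact hz)]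
    simp
  have h1 := derivative_lineRestr z i f
  rw [h0, Polynomial.derivative_zero] at h1
  have h2 := eval_lineRestr z i (z i) (MvPolynomial.pderiv i f)
  rw [← h1, Function.update_eq_self] at h2
  simpa using h2.symm

lemma VanAt.sub {t₀ : ℝ} {f g : MvPolynomial (Fin 4) ℝ} (hf : VanAt t₀ f) (hg : VanAt t₀ g) :
    VanAt t₀ (f - g) := by
  intro z hz
  simp [hf z hz, hg z hz]

lemma VanAt.curl4 {t₀ : ℝ} {F : Fin 3 → MvPolynomial (Fin 4) ℝ} (hF : ∀ i, VanAt t₀ (F i))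
    (i : Fin 3) : VanAt t₀ (curl4 F i) := by
  fin_cases i
  · exact ((hF 2).pderiv (by decide)).sub ((hF 1).pderiv (by decide))
  · exact ((hF 0).pderiv (by decide)).sub ((hF 2).pderiv (by decide))
  · exact ((hF 1).pderiv (by decide)).sub ((hF 0).pderiv (by decide))

lemma pderiv_comm' (i j : Fin 4) (f : MvPolynomial (Fin 4) ℝ) :
    pderiv i (pderiv j f) = pderiv j (pderiv i f) := by
  have h : ⁅(pderiv i : Derivation ℝ (MvPolynomial (Fin 4) ℝ) (MvPolynomial (Fin 4) ℝ)),
      (pderiv j : Derivation ℝ (MvPolynomial (Fin 4) ℝ) (MvPolynomial (Fin 4) ℝ))⁆ = 0 := by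
    refine MvPolynomial.derivation_ext (R := ℝ) fun k => ?_
    rw [Derivation.commutator_apply]
    classical
    simp only [pderiv_X, Pi.single_apply]
    split_ifs <;> simp
  have := DFunLike.congr_fun h f
  rw [Derivation.commutator_apply] at this
  exact sub_eq_zero.mp this

lemma curl4_pderiv (F : Fin 3 → MvPolynomial (Fin 4) ℝ) (i : Fin 3) :
    curl4 (fun j => pderiv 3 (F j)) i = pderiv 3 (curl4 F i) := by
  fin_cases i <;> simp [curl4, pderiv_comm' 3]

lemma eq_zero_of_iter {t₀ : ℝ} {f : MvPolynomial (Fin 4) ℝ}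
    (hf : ∀ k : ℕ, VanAt t₀ ((pderiv 3)^[k] f)) : f = 0 := by
  apply MvPolynomial.funext
  intro z
  have hit : ∀ (k : ℕ) (g : MvPolynomial (Fin 4) ℝ),
      Polynomial.derivative^[k] (lineRestr z 3 g) = lineRestr z 3 ((pderiv 3)^[k] g) := by
    intro k
    induction k with
    | zero => intro g; rfl
    | succ k ih =>
      intro g
      rw [Function.iterate_succ_apply, Function.iterate_succ_apply, derivative_lineRestr, ih]
  have h0 : lineRestr z 3 f = 0 := by
    by_contra hne
    refine lt_irrefl _ (Polynomial.lt_rootMultiplicity_of_isRoot_iterate_derivative (t := t₀)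
      (n := (lineRestr z 3 f).rootMultiplicity t₀) hne ?_)
    intro m _
    rw [hit, Polynomial.IsRoot.def, eval_lineRestr]
    exact hf m _ (by simp)
  have h2 := eval_lineRestr z 3 (z 3) f
  rw [h0, Function.update_eq_self] at h2
  simpa using h2.symm

lemma maxwell_iter {ε μ : ℝ} (hε : 0 < ε) (hμ : 0 < μ) {t₀ : ℝ} (k : ℕ) :
    ∀ (E H : Fin 3 → MvPolynomial (Fin 4) ℝ),
    (∀ i, ε • pderiv 3 (E i) = curl4 H i) → (∀ i, μ • pderiv 3 (H i) = - curl4 E i) →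
    (∀ i, VanAt t₀ (E i)) → (∀ i, VanAt t₀ (H i)) →
    (∀ i, VanAt t₀ ((pderiv 3)^[k] (E i))) ∧ (∀ i, VanAt t₀ ((pderiv 3)^[k] (H i))) := by
  induction k with
  | zero => intro E H _ _ hE hH; exact ⟨hE, hH⟩
  | succ k ih =>
    intro E H h1 h2 hE hH
    simp only [Function.iterate_succ_apply]
    refine ih (fun i => pderiv 3 (E i)) (fun i => pderiv 3 (H i)) ?_ ?_ ?_ ?_
    · intro i
      rw [curl4_pderiv, ← h1, Derivation.map_smul]
    · intro i
      rw [curl4_pderiv, ← map_neg, ← h2, Derivation.map_smul]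
    · intro i z hz
      have := VanAt.curl4 hH i z hz
      rw [← h1, smul_eval] at this
      exact (mul_eq_zero.mp this).resolve_left hε.ne'
    · intro i z hz
      have := VanAt.curl4 hE i z hz
      rw [← neg_eq_zero, ← map_neg, ← h2, smul_eval] at this
      exact (mul_eq_zero.mp this).resolve_left hμ.ne'

lemma vanAt_of_box {a b : Fin 3 → ℝ} (hab : ∀ i, a i < b i) {t₀ : ℝ}
    {f : MvPolynomial (Fin 4) ℝ}
    (h : ∀ x ∈ Set.pi Set.univ (fun i => Set.Ioo (a i) (b i)),
      eval (Fin.snoc x t₀ : Fin 4 → ℝ) f = 0) : VanAt t₀ f := by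
  let v : Fin 4 → MvPolynomial (Fin 3) ℝ := Fin.snoc (fun i : Fin 3 => X i) (C t₀)
  have hv : ∀ x : Fin 3 → ℝ, eval x (bind₁ v f) = eval (Fin.snoc x t₀ : Fin 4 → ℝ) f := by
    intro x
    rw [← MvPolynomial.coe_aeval_eq_eval, ← MvPolynomial.coe_aeval_eq_eval]
    simp only [RingHom.coe_coe]
    rw [aeval_bind₁]
    congr 2
    funext j
    refine Fin.lastCases ?_ (fun j => ?_) j
    · simp only [v, Fin.snoc_last, aeval_C, Algebra.algebraMap_self, RingHom.id_apply]
    · simp only [v, Fin.snoc_castSucc, aeval_X]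
  have h0 : bind₁ v f = 0 := by
    apply MvPolynomial.funext_set (fun i => Set.Ioo (a i) (b i))
      (fun i => Set.Ioo_infinite (hab i))
    intro x hx
    rw [hv, h x hx, map_zero]
  intro z hz
  have := hv (Fin.init z : Fin 3 → ℝ)
  rw [h0, map_zero, ← hz] at this
  have h3 : (Fin.snoc (Fin.init z : Fin 3 → ℝ) (z 3) : Fin 4 → ℝ) = z :=
    Fin.snoc_init_self z
  rw [h3] at this
  exact this.symm

lemma energyDensity_nonneg {ε μ : ℝ} (hε : 0 < ε) (hμ : 0 < μ)
    (E H : Fin 3 → MvPolynomial (Fin 4) ℝ) (x : Fin 3 → ℝ) (t : ℝ) :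
    0 ≤ energyDensity ε μ E H x t := by
  unfold energyDensity
  positivity

lemma energyDensity_smul (ε μ c : ℝ)
    (E H : Fin 3 → MvPolynomial (Fin 4) ℝ) (x : Fin 3 → ℝ) (t : ℝ) :
    energyDensity ε μ (c • E) (c • H) x t = c ^ 2 * energyDensity ε μ E H x t := by
  simp only [energyDensity, Pi.smul_apply, smul_eval, mul_pow, ← Finset.mul_sum]
  ring

lemma continuous_snoc_eval (f : MvPolynomial (Fin 4) ℝ) :
    Continuous (fun z : (Fin 3 → ℝ) × ℝ => eval (Fin.snoc z.1 z.2 : Fin 4 → ℝ) f) := by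
  refine (MvPolynomial.continuous_eval f).comp ?_
  refine continuous_pi fun j => ?_
  refine Fin.lastCases ?_ (fun j => ?_) j
  · simp only [Fin.snoc_last]
    exact continuous_snd
  · simp only [Fin.snoc_castSucc]
    fun_prop

lemma continuous_snoc_eval_left (f : MvPolynomial (Fin 4) ℝ) (t : ℝ) :
    Continuous (fun x : Fin 3 → ℝ => eval (Fin.snoc x t : Fin 4 → ℝ) f) := by
  have h : Continuous (fun x : Fin 3 → ℝ => (x, t)) := by fun_prop
  have h2 := (continuous_snoc_eval f).comp h
  simp only [Function.comp_def] at h2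
  exact h2

lemma continuous_energyDensity (ε μ : ℝ) (E H : Fin 3 → MvPolynomial (Fin 4) ℝ) (t : ℝ) :
    Continuous (fun x : Fin 3 → ℝ => energyDensity ε μ E H x t) := by
  unfold energyDensity
  have := continuous_snoc_eval_left
  fun_prop

lemma trefftz_pos {p : ℕ} {ε μ : ℝ} (hε : 0 < ε) (hμ : 0 < μ)
    {a b : Fin 3 → ℝ} (hab : ∀ i, a i < b i) (t₀ : ℝ)
    {EH : (Fin 3 → MvPolynomial (Fin 4) ℝ) × (Fin 3 → MvPolynomial (Fin 4) ℝ)}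
    (hEH : EH ∈ TrefftzSpace p ε μ) (hne : EH ≠ 0) :
    0 < ∫ x in Set.Icc a b, energyDensity ε μ EH.1 EH.2 x t₀ := by
  have hnn := fun x => energyDensity_nonneg hε hμ EH.1 EH.2 x t₀
  refine lt_of_le_of_ne (integral_nonneg hnn) fun h0 => hne ?_
  have hc : Continuous (fun x => energyDensity ε μ EH.1 EH.2 x t₀) :=
    continuous_energyDensity ε μ EH.1 EH.2 t₀
  have hae : (fun x => energyDensity ε μ EH.1 EH.2 x t₀) =ᵐ[volume.restrict (Set.Icc a b)] 0 :=
    (setIntegral_eq_zero_iff_of_nonneg_ae (Filter.Eventually.of_forall hnn)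
    (hc.continuousOn.integrableOn_compact isCompact_Icc)).mp h0.symm
  let U := Set.pi Set.univ (fun i => Set.Ioo (a i) (b i))
  have hUo : IsOpen U := isOpen_set_pi Set.finite_univ (fun i _ => isOpen_Ioo)
  have hUs : U ⊆ Set.Icc a b := fun x hx =>
    ⟨fun i => (hx i trivial).1.le, fun i => (hx i trivial).2.le⟩
  have hae' : (fun x => energyDensity ε μ EH.1 EH.2 x t₀) =ᵐ[volume.restrict U] 0 :=
    ae_mono (Measure.restrict_mono hUs le_rfl) hae
  have hU := Measure.eqOn_open_of_ae_eq (g := 0) hae' hUo hc.continuousOn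
    continuousOn_const
  have key : ∀ x ∈ U, (∀ i, eval (Fin.snoc x t₀ : Fin 4 → ℝ) (EH.1 i) = 0) ∧
      (∀ i, eval (Fin.snoc x t₀ : Fin 4 → ℝ) (EH.2 i) = 0) := by
    intro x hx
    have h := hU hx
    simp only [energyDensity, Pi.zero_apply] at h
    have hA : 0 ≤ ∑ i, (eval (Fin.snoc x t₀ : Fin 4 → ℝ) (EH.1 i)) ^ 2 := by positivity
    have hB : 0 ≤ ∑ i, (eval (Fin.snoc x t₀ : Fin 4 → ℝ) (EH.2 i)) ^ 2 := by positivity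
    obtain ⟨h1, h2⟩ := (add_eq_zero_iff_of_nonneg (mul_nonneg hε.le hA)
      (mul_nonneg hμ.le hB)).mp h
    have h1 := (mul_eq_zero.mp h1).resolve_left hε.ne'
    have h2 := (mul_eq_zero.mp h2).resolve_left hμ.ne'
    rw [Finset.sum_eq_zero_iff_of_nonneg (fun i _ => sq_nonneg _)] at h1 h2
    exact ⟨fun i => by simpa using h1 i (Finset.mem_univ i),
      fun i => by simpa using h2 i (Finset.mem_univ i)⟩
  have hE : ∀ i, VanAt t₀ (EH.1 i) := fun i => vanAt_of_box hab fun x hx => (key x hx).1 i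
  have hH : ∀ i, VanAt t₀ (EH.2 i) := fun i => vanAt_of_box hab fun x hx => (key x hx).2 i
  obtain ⟨-, -, h3, h4⟩ := hEH
  have hit := fun k => maxwell_iter hε hμ k EH.1 EH.2 h3 h4 hE hH
  refine Prod.ext (funext fun i => ?_) (funext fun i => ?_)
  · exact eq_zero_of_iter fun k => (hit k).1 i
  · exact eq_zero_of_iter fun k => (hit k).2 i

lemma trefftz_finite (p : ℕ) (ε μ : ℝ) : Module.Finite ℝ (TrefftzSpace p ε μ) := by
  let R := restrictTotalDegree (Fin 4) ℝ p
  let L : TrefftzSpace p ε μ →ₗ[ℝ] (Fin 3 → R) × (Fin 3 → R) :=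
    { toFun := fun v => (fun i => ⟨v.1.1 i, (mem_restrictTotalDegree _ _ _).mpr (v.2.1 i)⟩,
        fun i => ⟨v.1.2 i, (mem_restrictTotalDegree _ _ _).mpr (v.2.2.1 i)⟩)
      map_add' := fun _ _ => rfl
      map_smul' := fun _ _ => rfl }
  refine Module.Finite.of_injective L fun v w h => ?_
  apply Subtype.ext
  refine Prod.ext (funext fun i => ?_) (funext fun i => ?_)
  · exact congrArg Subtype.val (congrFun (congrArg Prod.fst h) i)
  · exact congrArg Subtype.val (congrFun (congrArg Prod.snd h) i)

lemma quad_bound {n : ℕ} (Q₁ Q₂ : (Fin n → ℝ) → ℝ) (h1 : Continuous Q₁) (h2 : Continuous Q₂)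
    (s1 : ∀ (c : ℝ) v, Q₁ (c • v) = c ^ 2 * Q₁ v) (s2 : ∀ (c : ℝ) v, Q₂ (c • v) = c ^ 2 * Q₂ v)
    (hpos : ∀ v, v ≠ 0 → 0 < Q₂ v) : ∃ C > 0, ∀ v, Q₁ v ≤ C * Q₂ v := by
  have hs : IsCompact (Metric.sphere (0 : Fin n → ℝ) 1) := isCompact_sphere _ _
  have hp : ∀ v ∈ Metric.sphere (0 : Fin n → ℝ) 1, 0 < Q₂ v := fun v hv =>
    hpos v (by rintro rfl; simp at hv)
  have hc : ContinuousOn (fun v => Q₁ v / Q₂ v) (Metric.sphere (0 : Fin n → ℝ) 1) :=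
    h1.continuousOn.div h2.continuousOn fun v hv => (hp v hv).ne'
  obtain ⟨M, hM⟩ := (hs.image_of_continuousOn hc).bddAbove
  refine ⟨max M 1, by positivity, fun v => ?_⟩
  by_cases hv : v = 0
  · have e1 := s1 0 v
    have e2 := s2 0 v
    subst hv
    simp at e1 e2
    simp [e1, e2]
  · have hn : ‖v‖ ≠ 0 := norm_ne_zero_iff.mpr hv
    have hw : ‖v‖⁻¹ • v ∈ Metric.sphere (0 : Fin n → ℝ) 1 := by
      simp [norm_smul, hn]
    have hb : Q₁ (‖v‖⁻¹ • v) / Q₂ (‖v‖⁻¹ • v) ≤ max M 1 :=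
      (hM ⟨_, hw, rfl⟩).trans (le_max_left _ _)
    rw [div_le_iff₀ (hp _ hw), s1, s2, ← mul_assoc, mul_comm (max M 1), mul_assoc] at hb
    exact le_of_mul_le_mul_left hb (by positivity)

/-- Joint continuity of the energy density in the coefficients and the point. -/
lemma continuous_energyDensity_coeff (ε μ : ℝ) {n : ℕ}
    (B : Fin n → (Fin 3 → MvPolynomial (Fin 4) ℝ) × (Fin 3 → MvPolynomial (Fin 4) ℝ)) :
    Continuous (fun q : (Fin n → ℝ) × ((Fin 3 → ℝ) × ℝ) =>
      energyDensity ε μ (∑ j, q.1 j • B j).1 (∑ j, q.1 j • B j).2 q.2.1 q.2.2) := by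
  simp only [energyDensity, Prod.fst_sum, Prod.snd_sum, Finset.sum_apply, Prod.smul_fst,
    Prod.smul_snd, Pi.smul_apply, map_sum, smul_eval]
  have h := fun f => (continuous_snoc_eval f).comp
    (continuous_snd : Continuous (Prod.snd : (Fin n → ℝ) × ((Fin 3 → ℝ) × ℝ) → _))
  simp only [Function.comp_def] at h
  fun_prop

lemma continuous_energyDensity_coeff_left (ε μ : ℝ) {n : ℕ}
    (B : Fin n → (Fin 3 → MvPolynomial (Fin 4) ℝ) × (Fin 3 → MvPolynomial (Fin 4) ℝ)) (t : ℝ) :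
    Continuous (fun q : (Fin n → ℝ) × (Fin 3 → ℝ) =>
      energyDensity ε μ (∑ j, q.1 j • B j).1 (∑ j, q.1 j • B j).2 q.2 t) := by
  simp only [energyDensity, Prod.fst_sum, Prod.snd_sum, Finset.sum_apply, Prod.smul_fst,
    Prod.smul_snd, Pi.smul_apply, map_sum, smul_eval]
  have h := fun f => (continuous_snoc_eval_left f t).comp
    (continuous_snd : Continuous (Prod.snd : (Fin n → ℝ) × (Fin 3 → ℝ) → _))
  simp only [Function.comp_def] at h
  fun_prop

/-- Stability of Trefftz polynomials: the space-time energy over `K × [t₀, t₁]` is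
bounded by a constant times the energy of the initial values at time `t₀`. -/
theorem trefftz_space_time_stability (p : ℕ) (ε μ : ℝ) (hε : 0 < ε) (hμ : 0 < μ)
    (a b : Fin 3 → ℝ) (hab : ∀ i, a i < b i) (t₀ t₁ : ℝ) (ht : t₀ < t₁) :
    ∃ C > 0, ∀ EH ∈ TrefftzSpace p ε μ,
      (∫ z in Set.Icc a b ×ˢ Set.Icc t₀ t₁, energyDensity ε μ EH.1 EH.2 z.1 z.2) ≤
        C * ∫ x in Set.Icc a b, energyDensity ε μ EH.1 EH.2 x t₀ := by
  have := trefftz_finite p ε μ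
  let bs := Module.finBasis ℝ (TrefftzSpace p ε μ)
  let B := fun j => (bs j : (Fin 3 → MvPolynomial (Fin 4) ℝ) × (Fin 3 → MvPolynomial (Fin 4) ℝ))
  have hB : ∀ c : Fin _ → ℝ, ((bs.equivFun.symm c : TrefftzSpace p ε μ) :
      (Fin 3 → MvPolynomial (Fin 4) ℝ) × (Fin 3 → MvPolynomial (Fin 4) ℝ)) = ∑ j, c j • B j := by
    intro c
    simp [B, Module.Basis.equivFun_symm_apply]
  have hj := continuous_energyDensity_coeff ε μ B
  obtain ⟨C, hC, hb⟩ := quad_bound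
    (fun c => ∫ z in Set.Icc a b ×ˢ Set.Icc t₀ t₁,
      energyDensity ε μ (∑ j, c j • B j).1 (∑ j, c j • B j).2 z.1 z.2)
    (fun c => ∫ x in Set.Icc a b,
      energyDensity ε μ (∑ j, c j • B j).1 (∑ j, c j • B j).2 x t₀)
    (continuous_parametric_integral_of_continuous hj (isCompact_Icc.prod isCompact_Icc))
    (continuous_parametric_integral_of_continuous
      (f := fun (c : Fin _ → ℝ) (x : Fin 3 → ℝ) =>
        energyDensity ε μ (∑ j, c j • B j).1 (∑ j, c j • B j).2 x t₀)
      (continuous_energyDensity_coeff_left ε μ B t₀)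
      isCompact_Icc)
    (by
      intro c v
      have : (∑ j, (c • v) j • B j) = c • ∑ j, v j • B j := by
        simp [Finset.smul_sum, mul_smul]
      simp only [this, Prod.smul_fst, Prod.smul_snd, energyDensity_smul, integral_const_mul])
    (by
      intro c v
      have : (∑ j, (c • v) j • B j) = c • ∑ j, v j • B j := by
        simp [Finset.smul_sum, mul_smul]
      simp only [this, Prod.smul_fst, Prod.smul_snd, energyDensity_smul, integral_const_mul])
    (by
      intro v hv
      rw [← hB]
      refine trefftz_pos hε hμ hab t₀ (bs.equivFun.symm v).2 ?_
      intro h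
      exact hv (bs.equivFun.symm.map_eq_zero_iff.mp (Subtype.ext h)))
  refine ⟨C, hC, fun EH hEH => ?_⟩
  have := hb (bs.equivFun ⟨EH, hEH⟩)
  rw [← hB, LinearEquiv.symm_apply_apply] at this
  exact this

end
end

section
/- Let ε, μ > 0 be real constants, let K = [a₁,b₁] × [a₂,b₂] × [a₃,b₃] ⊂ ℝ³ be a closed box with aᵢ < bᵢ for all i, and let t₀ < t₁ be reals. Let E, H : ℝ³ × ℝ → ℝ³ be continuously differentiable and satisfy pointwise on K × [t₀,t₁] the Maxwell equations ε·∂ₜE = curl H and μ·∂ₜH = −curl E. Then ½·∫_K (ε·|E(x,t₁)|² + μ·|H(x,t₁)|²) dx − ½·∫_K (ε·|E(x,t₀)|² + μ·|H(x,t₀)|²) dx = −∫_{t₀}^{t₁} Φ(t) dt, where the boundary flux Φ(t) is the sum over i = 1, 2, 3 of the difference between the integral of the i-th component of the Poynting vector S = E × H over the face of K where xᵢ = bᵢ and its integral over the face where xᵢ = aᵢ, each face integral taken with respect to two-dimensional Lebesgue measure in the remaining two coordinates. -/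
open MeasureTheory

noncomputable section

/-- The cross product of two vectors in `ℝ³`. -/
def cross3 (u v : Fin 3 → ℝ) : Fin 3 → ℝ :=
  ![u 1 * v 2 - u 2 * v 1, u 2 * v 0 - u 0 * v 2, u 0 * v 1 - u 1 * v 0]

/-- The partial derivative of the `j`-th component of a time dependent vector field
`F : ℝ³ × ℝ → ℝ³` in the `i`-th spatial coordinate direction at the point `z = (x, t)`. -/
def spaceDeriv (F : ((Fin 3 → ℝ) × ℝ) → (Fin 3 → ℝ)) (i j : Fin 3)
    (z : (Fin 3 → ℝ) × ℝ) : ℝ :=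
  fderiv ℝ (fun w => F w j) z (Pi.single i 1, 0)

/-- The partial derivative of the `j`-th component of a time dependent vector field
`F : ℝ³ × ℝ → ℝ³` in the time variable at the point `z = (x, t)`. -/
def timeDeriv (F : ((Fin 3 → ℝ) × ℝ) → (Fin 3 → ℝ)) (j : Fin 3)
    (z : (Fin 3 → ℝ) × ℝ) : ℝ :=
  fderiv ℝ (fun w => F w j) z (0, 1)

/-- The spatial curl of a time dependent vector field `F : ℝ³ × ℝ → ℝ³`. -/
def curlTVF (F : ((Fin 3 → ℝ) × ℝ) → (Fin 3 → ℝ)) (z : (Fin 3 → ℝ) × ℝ) : Fin 3 → ℝ :=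
  ![spaceDeriv F 1 2 z - spaceDeriv F 2 1 z,
    spaceDeriv F 2 0 z - spaceDeriv F 0 2 z,
    spaceDeriv F 0 1 z - spaceDeriv F 1 0 z]

/-- Fundamental theorem of calculus in time, integrated over the box. -/
theorem box_ftc (a b : Fin 3 → ℝ) (t₀ t₁ : ℝ) (ht : t₀ ≤ t₁)
    (g : (Fin 3 → ℝ) × ℝ → ℝ) (hg : ContDiff ℝ 1 g) :
    (∫ x in Set.Icc a b, g (x, t₁)) - (∫ x in Set.Icc a b, g (x, t₀)) =
      ∫ t in t₀..t₁, ∫ x in Set.Icc a b, fderiv ℝ g (x, t) (0, 1) := by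
  have hc : Continuous g := hg.continuous
  have hd : Continuous (fun z => fderiv ℝ g z (0, 1)) :=
    (hg.continuous_fderiv one_ne_zero).clm_apply continuous_const
  have hi : ∀ t, IntegrableOn (fun x => g (x, t)) (Set.Icc a b) := fun t =>
    (by fun_prop : Continuous (fun x => g (x, t))).continuousOn.integrableOn_compact isCompact_Icc
  rw [← integral_sub (hi _) (hi _)]
  have h1 : ∀ x, g (x, t₁) - g (x, t₀) = ∫ t in t₀..t₁, fderiv ℝ g (x, t) (0, 1) := by
    intro x
    symm
    apply intervalIntegral.integral_eq_sub_of_hasDerivAt (f := fun t => g (x, t))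
    · intro t _
      have h := (hg.differentiable one_ne_zero (x, t)).hasFDerivAt
      have h2 : HasDerivAt (fun t : ℝ => (x, t)) ((0 : Fin 3 → ℝ), (1 : ℝ)) t :=
        (hasDerivAt_const t x).prodMk (hasDerivAt_id t)
      exact h.comp_hasDerivAt t h2
    · exact (hd.comp (by fun_prop : Continuous (fun t : ℝ => (x, t)))).intervalIntegrable _ _
  simp only [h1, intervalIntegral.integral_of_le ht]
  apply integral_integral_swap
  rw [Measure.prod_restrict]
  have : IntegrableOn (fun z => fderiv ℝ g z (0, 1)) (Set.Icc a b ×ˢ Set.Icc t₀ t₁) :=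
    hd.continuousOn.integrableOn_compact (isCompact_Icc.prod isCompact_Icc)
  exact this.mono_set (Set.prod_mono le_rfl Set.Ioc_subset_Icc_self)

/-- A box integral over `Fin 2 → ℝ` as an integral over `ℝ × ℝ`. -/
theorem face_integral (c d : Fin 2 → ℝ) (f : (Fin 2 → ℝ) → ℝ) :
    ∫ x in Set.Icc c d, f x =
      ∫ y in Set.Icc (c 0) (d 0) ×ˢ Set.Icc (c 1) (d 1), f ![y.1, y.2] := by
  have h := (volume_preserving_finTwoArrow ℝ).symm
  rw [← h.setIntegral_preimage_emb (MeasurableEquiv.measurableEmbedding _)]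
  have hs : (MeasurableEquiv.finTwoArrow.symm : ℝ × ℝ ≃ᵐ (Fin 2 → ℝ)) ⁻¹' Set.Icc c d =
      Set.Icc (c 0) (d 0) ×ˢ Set.Icc (c 1) (d 1) := by
    ext y
    simp [MeasurableEquiv.finTwoArrow, Pi.le_def, Fin.forall_fin_two, Prod.le_def]
  rw [hs]
  rfl

/-- Divergence theorem on the box. -/
theorem box_div (a b : Fin 3 → ℝ) (hab : a ≤ b) (f : Fin 3 → (Fin 3 → ℝ) → ℝ)
    (hf : ∀ i, ContDiff ℝ 1 (f i)) :
    ∫ x in Set.Icc a b, ∑ i, fderiv ℝ (f i) x (Pi.single i 1) =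
        (((∫ y in Set.Icc (a 1) (b 1) ×ˢ Set.Icc (a 2) (b 2), f 0 ![b 0, y.1, y.2]) -
          ∫ y in Set.Icc (a 1) (b 1) ×ˢ Set.Icc (a 2) (b 2), f 0 ![a 0, y.1, y.2]) +
        ((∫ y in Set.Icc (a 0) (b 0) ×ˢ Set.Icc (a 2) (b 2), f 1 ![y.1, b 1, y.2]) -
          ∫ y in Set.Icc (a 0) (b 0) ×ˢ Set.Icc (a 2) (b 2), f 1 ![y.1, a 1, y.2]) +
        ((∫ y in Set.Icc (a 0) (b 0) ×ˢ Set.Icc (a 1) (b 1), f 2 ![y.1, y.2, b 2]) -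
          ∫ y in Set.Icc (a 0) (b 0) ×ˢ Set.Icc (a 1) (b 1), f 2 ![y.1, y.2, a 2])) := by
  have hd : Continuous (fun x => ∑ i, fderiv ℝ (f i) x (Pi.single i 1)) :=
    continuous_finsetSum _ fun i _ =>
      ((hf i).continuous_fderiv one_ne_zero).clm_apply continuous_const
  rw [integral_divergence_of_hasFDerivAt_off_countable' a b hab f (fun i => fderiv ℝ (f i)) ∅
    Set.countable_empty (fun i => (hf i).continuous.continuousOn)
    (fun x _ i => ((hf i).differentiable one_ne_zero x).hasFDerivAt)
    (hd.continuousOn.integrableOn_compact isCompact_Icc)]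
  rw [Fin.sum_univ_three]
  simp only [face_integral]
  have e0 : ∀ c p q : ℝ, (Fin.insertNth (0 : Fin 3) c ![p, q] : Fin 3 → ℝ) = ![c, p, q] := by
    intro c p q; ext i; fin_cases i <;> rfl
  have e1 : ∀ c p q : ℝ, (Fin.insertNth (1 : Fin 3) c ![p, q] : Fin 3 → ℝ) = ![p, c, q] := by
    intro c p q; ext i; fin_cases i <;> rfl
  have e2 : ∀ c p q : ℝ, (Fin.insertNth (2 : Fin 3) c ![p, q] : Fin 3 → ℝ) = ![p, q, c] := by
    intro c p q; ext i; fin_cases i <;> rfl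
  simp only [e0, e1, e2]
  rfl

/-- The integrated Poynting (energy) identity on a space-time box: the change of the
electromagnetic energy `½ ∫_K (ε|E|² + μ|H|²)` between the times `t₀` and `t₁` equals
minus the time integral of the outward flux of the Poynting vector `S = E × H`
through the six faces of the box `K`. -/
theorem poynting_energy_identity (ε μ : ℝ) (hε : 0 < ε) (hμ : 0 < μ)
    (a b : Fin 3 → ℝ) (hab : ∀ i, a i < b i) (t₀ t₁ : ℝ) (ht : t₀ < t₁)
    (E H : ((Fin 3 → ℝ) × ℝ) → (Fin 3 → ℝ))
    (hE : ContDiff ℝ 1 E) (hH : ContDiff ℝ 1 H)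
    (hME : ∀ z ∈ Set.Icc a b ×ˢ Set.Icc t₀ t₁, ∀ j,
      ε * timeDeriv E j z = curlTVF H z j)
    (hMH : ∀ z ∈ Set.Icc a b ×ˢ Set.Icc t₀ t₁, ∀ j,
      μ * timeDeriv H j z = - curlTVF E z j) :
    (1 / 2) * (∫ x in Set.Icc a b,
        (ε * ∑ j, (E (x, t₁) j) ^ 2 + μ * ∑ j, (H (x, t₁) j) ^ 2)) -
      (1 / 2) * (∫ x in Set.Icc a b,
        (ε * ∑ j, (E (x, t₀) j) ^ 2 + μ * ∑ j, (H (x, t₀) j) ^ 2)) =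
    - ∫ t in t₀..t₁,
        (((∫ y in Set.Icc (a 1) (b 1) ×ˢ Set.Icc (a 2) (b 2),
            cross3 (E (![b 0, y.1, y.2], t)) (H (![b 0, y.1, y.2], t)) 0) -
          ∫ y in Set.Icc (a 1) (b 1) ×ˢ Set.Icc (a 2) (b 2),
            cross3 (E (![a 0, y.1, y.2], t)) (H (![a 0, y.1, y.2], t)) 0) +
        ((∫ y in Set.Icc (a 0) (b 0) ×ˢ Set.Icc (a 2) (b 2),
            cross3 (E (![y.1, b 1, y.2], t)) (H (![y.1, b 1, y.2], t)) 1) -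
          ∫ y in Set.Icc (a 0) (b 0) ×ˢ Set.Icc (a 2) (b 2),
            cross3 (E (![y.1, a 1, y.2], t)) (H (![y.1, a 1, y.2], t)) 1) +
        ((∫ y in Set.Icc (a 0) (b 0) ×ˢ Set.Icc (a 1) (b 1),
            cross3 (E (![y.1, y.2, b 2], t)) (H (![y.1, y.2, b 2], t)) 2) -
          ∫ y in Set.Icc (a 0) (b 0) ×ˢ Set.Icc (a 1) (b 1),
            cross3 (E (![y.1, y.2, a 2], t)) (H (![y.1, y.2, a 2], t)) 2)) := by
  have hEj : ∀ j, ContDiff ℝ 1 (fun w => E w j) := fun j => contDiff_pi.1 hE j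
  have hHj : ∀ j, ContDiff ℝ 1 (fun w => H w j) := fun j => contDiff_pi.1 hH j
  have dE : ∀ j z, DifferentiableAt ℝ (fun w => E w j) z :=
    fun j z => (hEj j).differentiable one_ne_zero z
  have dH : ∀ j z, DifferentiableAt ℝ (fun w => H w j) z :=
    fun j z => (hHj j).differentiable one_ne_zero z
  -- the energy density
  have hu : ContDiff ℝ 1 (fun z => (1 / 2) * (ε * ∑ j, (E z j) ^ 2 + μ * ∑ j, (H z j) ^ 2)) := by
    have h1 : ContDiff ℝ 1 (fun z => ∑ j, (E z j) ^ 2) :=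
      ContDiff.sum fun j _ => (hEj j).pow 2
    have h2 : ContDiff ℝ 1 (fun z => ∑ j, (H z j) ^ 2) :=
      ContDiff.sum fun j _ => (hHj j).pow 2
    exact contDiff_const.mul ((contDiff_const.mul h1).add (contDiff_const.mul h2))
  have hut : ∀ z, fderiv ℝ (fun z => (1 / 2) * (ε * ∑ j, (E z j) ^ 2 + μ * ∑ j, (H z j) ^ 2)) z
      (0, 1) = ∑ j, (E z j * (ε * timeDeriv E j z) + H z j * (μ * timeDeriv H j z)) := by
    intro z
    have h1 := HasFDerivAt.fun_sum (u := Finset.univ) fun j _ => ((dE j z).hasFDerivAt.pow 2)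
    have h2 := HasFDerivAt.fun_sum (u := Finset.univ) fun j _ => ((dH j z).hasFDerivAt.pow 2)
    have h3 := ((h1.const_mul ε).add (h2.const_mul μ)).const_mul (1 / 2)
    have h4 := h3.fderiv
    have h5 := congrArg (fun L => L (0, 1)) h4
    refine Eq.trans h5 ?_
    simp [Fin.sum_univ_three, timeDeriv]
    ring
  have hSs : ∀ i : Fin 3, ContDiff ℝ 1 (fun z => cross3 (E z) (H z) i) := by
    intro i
    fin_cases i
    · exact ((hEj 1).mul (hHj 2)).sub ((hEj 2).mul (hHj 1))
    · exact ((hEj 2).mul (hHj 0)).sub ((hEj 0).mul (hHj 2))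
    · exact ((hEj 0).mul (hHj 1)).sub ((hEj 1).mul (hHj 0))
  have hprod : ∀ (i j k : Fin 3) (x : Fin 3 → ℝ) (t : ℝ),
      fderiv ℝ (fun x => E (x, t) j * H (x, t) k - E (x, t) k * H (x, t) j) x (Pi.single i 1) =
        E (x, t) j * spaceDeriv H i k (x, t) + H (x, t) k * spaceDeriv E i j (x, t) -
        (E (x, t) k * spaceDeriv H i j (x, t) + H (x, t) j * spaceDeriv E i k (x, t)) := by
    intro i j k x t
    have hι : HasFDerivAt (fun x : Fin 3 → ℝ => (x, t))
        (ContinuousLinearMap.inl ℝ (Fin 3 → ℝ) ℝ) x := hasFDerivAt_prodMk_left x t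
    have hEE : ∀ j, HasFDerivAt (fun x => E (x, t) j)
        ((fderiv ℝ (fun w => E w j) (x, t)).comp (ContinuousLinearMap.inl ℝ (Fin 3 → ℝ) ℝ)) x :=
      fun j => HasFDerivAt.comp (g := fun w => E w j) x (dE j (x, t)).hasFDerivAt hι
    have hHH : ∀ j, HasFDerivAt (fun x => H (x, t) j)
        ((fderiv ℝ (fun w => H w j) (x, t)).comp (ContinuousLinearMap.inl ℝ (Fin 3 → ℝ) ℝ)) x :=
      fun j => HasFDerivAt.comp (g := fun w => H w j) x (dH j (x, t)).hasFDerivAt hι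
    have h4 := (((hEE j).mul (hHH k)).sub ((hEE k).mul (hHH j))).fderiv
    have h5 := congrArg (fun L => L (Pi.single i 1)) h4
    refine Eq.trans h5 ?_
    simp [spaceDeriv]
  have hdiv : ∀ t x, ∑ i, fderiv ℝ (fun x => cross3 (E (x, t)) (H (x, t)) i) x (Pi.single i 1) =
      ∑ j, (H (x, t) j * curlTVF E (x, t) j - E (x, t) j * curlTVF H (x, t) j) := by
    intro t x
    rw [Fin.sum_univ_three, Fin.sum_univ_three]
    have h0 := hprod 0 1 2 x t
    have h1 := hprod 1 2 0 x t
    have h2 := hprod 2 0 1 x t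
    simp only [cross3, curlTVF, Matrix.cons_val]
    rw [h0, h1, h2]
    ring
  have key := box_ftc a b t₀ t₁ ht.le _ hu
  simp only [integral_const_mul] at key
  rw [key, ← intervalIntegral.integral_neg]
  apply intervalIntegral.integral_congr
  intro t htt
  rw [Set.uIcc_of_le ht.le] at htt
  have hB := box_div a b (fun i => (hab i).le) (fun i x => cross3 (E (x, t)) (H (x, t)) i)
    (fun i => (hSs i).comp (contDiff_id.prodMk contDiff_const))
  refine Eq.trans ?_ (congrArg Neg.neg hB)
  rw [← integral_neg]
  apply setIntegral_congr_fun measurableSet_Icc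
  intro x hx
  have hz : (x, t) ∈ Set.Icc a b ×ˢ Set.Icc t₀ t₁ := ⟨hx, htt⟩
  show fderiv ℝ _ (x, t) (0, 1) = - ∑ i, _
  rw [hut, hdiv, ← Finset.sum_neg_distrib]
  refine Finset.sum_congr rfl fun j _ => ?_
  rw [hME _ hz, hMH _ hz]
  ring

end
end
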